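/- Let G be a finite group and ((A^(i), G, α^(i)), φ_i)_{i∈ℕ} an inductive sequence of partial dynamical systems in which every A^(i) is a unital C*-algebra and every φ_i is a unital *-homomorphism. Let (A, (μ_i)) be a concrete inductive limit of (A^(i), φ_i) with each μ_i unital (so A is unital), and let α be the inductive limit partial action of G on A. If k ∈ ℕ and there are infinitely many i ∈ ℕ such that α^(i) has Rokhlin dimension with commuting towers at most k, then α has Rokhlin dimension with commuting towers at most k. In particular, dim^c_Rok(α) ≤ liminf_{i→∞} dim^c_Rok(α^(i)). -/

import Mathlib

open scoped ComplexOrder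

/-- A partial action of a discrete group `G` on a C*-algebra `A`, encoded elementwise:
`I g` is the closed two-sided ideal `A_g`, and `θ g : A → A` is a (total extension of the)
*-isomorphism `α_g : A_{g⁻¹} → A_g`; all axioms are only imposed on the relevant ideals. -/
structure CStarPartialAction (G : Type*) [Group G] (A : Type*)
    [NonUnitalNormedRing A] [StarRing A] [Module ℂ A] where
  I : G → Set A
  isClosed : ∀ g, IsClosed (I g)
  zero_mem : ∀ g, (0 : A) ∈ I g
  add_mem : ∀ g, ∀ a ∈ I g, ∀ b ∈ I g, a + b ∈ I g
  smul_mem : ∀ g (c : ℂ), ∀ a ∈ I g, c • a ∈ I g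
  mul_mem_left : ∀ g (x : A), ∀ a ∈ I g, x * a ∈ I g
  mul_mem_right : ∀ g (x : A), ∀ a ∈ I g, a * x ∈ I g
  star_mem : ∀ g, ∀ a ∈ I g, star a ∈ I g
  θ : G → A → A
  mapsTo : ∀ g, ∀ a ∈ I g⁻¹, θ g a ∈ I g
  θ_add : ∀ g, ∀ a ∈ I g⁻¹, ∀ b ∈ I g⁻¹, θ g (a + b) = θ g a + θ g b
  θ_smul : ∀ g (c : ℂ), ∀ a ∈ I g⁻¹, θ g (c • a) = c • θ g a
  θ_mul : ∀ g, ∀ a ∈ I g⁻¹, ∀ b ∈ I g⁻¹, θ g (a * b) = θ g a * θ g b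
  θ_star : ∀ g, ∀ a ∈ I g⁻¹, θ g (star a) = star (θ g a)
  θ_surjOn : ∀ g, ∀ b ∈ I g, ∃ a ∈ I g⁻¹, θ g a = b
  θ_injOn : ∀ g, ∀ a ∈ I g⁻¹, ∀ b ∈ I g⁻¹, θ g a = θ g b → a = b
  I_one : I 1 = Set.univ
  θ_one : ∀ a : A, θ 1 a = a
  mem_comp : ∀ g h, ∀ x ∈ I h⁻¹, θ h x ∈ I g⁻¹ → x ∈ I (g * h)⁻¹
  θ_comp : ∀ g h, ∀ x ∈ I h⁻¹, θ h x ∈ I g⁻¹ → θ g (θ h x) = θ (g * h) x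

/-- A map `φ : A → B` is `G`-equivariant with respect to partial actions `α` on `A` and
`β` on `B` if `φ(A_g) ⊆ B_g` and `φ ∘ α_g = β_g ∘ φ` on `A_{g⁻¹}`. -/
def IsEquivariantMap {G : Type*} [Group G] {A B : Type*}
    [NonUnitalNormedRing A] [StarRing A] [Module ℂ A]
    [NonUnitalNormedRing B] [StarRing B] [Module ℂ B]
    (α : CStarPartialAction G A) (β : CStarPartialAction G B) (φ : A → B) : Prop :=
  (∀ g, φ '' α.I g ⊆ β.I g) ∧ ∀ g, ∀ a ∈ α.I g⁻¹, φ (α.θ g a) = β.θ g (φ a)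

/-- The composite `φ_{i,i+j} = φ_{i+j-1} ∘ ⋯ ∘ φ_i : A_i → A_{i+j}` of the connecting maps
of an inductive sequence. -/
def iterMap {A : ℕ → Type*} (φ : ∀ i, A i → A (i + 1)) (i : ℕ) : (j : ℕ) → A i → A (i + j)
  | 0 => id
  | j + 1 => fun a => φ (i + j) (iterMap φ i j a)

/-- A partial action `α` of a finite group `G` on a unital C*-algebra `A` has Rokhlin
dimension at most `k`: for every `ε > 0` and finite `F ⊆ A` there are positive contractions
`f j g ∈ A_g` (`j = 0, …, k`, `g ∈ G`) satisfying the four Rokhlin tower conditions. -/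
def HasRokhlinDimLE {G : Type*} [Group G] [Fintype G] {A : Type*}
    [NormedRing A] [StarRing A] [Module ℂ A] [PartialOrder A]
    (α : CStarPartialAction G A) (k : ℕ) : Prop :=
  ∀ ε : ℝ, 0 < ε → ∀ F : Finset A, ∃ f : Fin (k + 1) → G → A,
    (∀ (j : Fin (k + 1)) (g : G), f j g ∈ α.I g ∧ 0 ≤ f j g ∧ ‖f j g‖ ≤ 1) ∧
    (∀ (g h : G) (j : Fin (k + 1)), ∀ x ∈ F, x ∈ α.I g⁻¹ →
      ‖α.θ g (f j h * x) - f j (g * h) * α.θ g x‖ < ε) ∧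
    (∀ (j : Fin (k + 1)) (g h : G), g ≠ h → ‖f j g * f j h‖ < ε) ∧
    ‖(∑ j : Fin (k + 1), ∑ g : G, f j g) - 1‖ < ε ∧
    (∀ (j : Fin (k + 1)) (g : G), ∀ a ∈ F, ‖f j g * a - a * f j g‖ < ε)

/-- Rokhlin dimension with commuting towers at most `k`: in addition, the towers can be
chosen to approximately commute with each other. -/
def HasRokhlinDimWithCommutingTowersLE {G : Type*} [Group G] [Fintype G] {A : Type*}
    [NormedRing A] [StarRing A] [Module ℂ A] [PartialOrder A]
    (α : CStarPartialAction G A) (k : ℕ) : Prop :=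
  ∀ ε : ℝ, 0 < ε → ∀ F : Finset A, ∃ f : Fin (k + 1) → G → A,
    (∀ (j : Fin (k + 1)) (g : G), f j g ∈ α.I g ∧ 0 ≤ f j g ∧ ‖f j g‖ ≤ 1) ∧
    (∀ (g h : G) (j : Fin (k + 1)), ∀ x ∈ F, x ∈ α.I g⁻¹ →
      ‖α.θ g (f j h * x) - f j (g * h) * α.θ g x‖ < ε) ∧
    (∀ (j : Fin (k + 1)) (g h : G), g ≠ h → ‖f j g * f j h‖ < ε) ∧
    ‖(∑ j : Fin (k + 1), ∑ g : G, f j g) - 1‖ < ε ∧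
    (∀ (j : Fin (k + 1)) (g : G), ∀ a ∈ F, ‖f j g * a - a * f j g‖ < ε) ∧
    (∀ (j l : Fin (k + 1)) (g h : G), ‖f j g * f l h - f l h * f j g‖ < ε)

namespace CStarPartialAction

variable {G : Type*} [Group G] {L : Type*} [CStarAlgebra L] (α : CStarPartialAction G L)

/-- The ideal `A_g` of a partial action as a non-unital star subalgebra. -/
def ideal (g : G) : NonUnitalStarSubalgebra ℂ L where
  carrier := α.I g
  zero_mem' := α.zero_mem g
  add_mem' ha hb := α.add_mem g _ ha _ hb
  mul_mem' _ hb := α.mul_mem_left g _ _ hb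
  smul_mem' c _ ha := α.smul_mem g c _ ha
  star_mem' ha := α.star_mem g _ ha

lemma θ_zero (g : G) : α.θ g 0 = 0 := by
  simpa using α.θ_smul g 0 0 (α.zero_mem _)

lemma sub_mem (g : G) {a b : L} (ha : a ∈ α.I g) (hb : b ∈ α.I g) : a - b ∈ α.I g :=
  _root_.sub_mem (S := NonUnitalStarSubalgebra ℂ L) (H := α.ideal g) ha hb

lemma θ_sub (g : G) {a b : L} (ha : a ∈ α.I g⁻¹) (hb : b ∈ α.I g⁻¹) :
    α.θ g (a - b) = α.θ g a - α.θ g b := by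
  rw [eq_sub_iff_add_eq, ← α.θ_add g _ (α.sub_mem _ ha hb) _ hb, sub_add_cancel]

/-- The isomorphism `α_g : A_{g⁻¹} → A_g` of a partial action, as a star homomorphism into the
ambient algebra. -/
def idealHom (g : G) : α.ideal g⁻¹ →⋆ₙₐ[ℂ] L where
  toFun a := α.θ g a
  map_smul' c a := α.θ_smul g c _ a.2
  map_zero' := α.θ_zero g
  map_add' a b := α.θ_add g _ a.2 _ b.2
  map_mul' a b := α.θ_mul g _ a.2 _ b.2
  map_star' a := α.θ_star g _ a.2

lemma norm_θ_le (g : G) {a : L} (ha : a ∈ α.I g⁻¹) : ‖α.θ g a‖ ≤ ‖a‖ := by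
  have : IsClosed (α.ideal g⁻¹ : Set L) := α.isClosed _
  exact NonUnitalStarAlgHom.norm_apply_le (α.idealHom g) ⟨a, ha⟩

/-- The covariance defect of contractions `p`, `q` at `x` is controlled by the one at a nearby
point `y`. -/
lemma norm_θ_mul_sub_lt (g : G) {p q x y : L} {δ : ℝ} (hp : ‖p‖ ≤ 1) (hq : ‖q‖ ≤ 1)
    (hx : x ∈ α.I g⁻¹) (hy : y ∈ α.I g⁻¹) (hxy : ‖x - y‖ < δ)
    (h : ‖α.θ g (p * y) - q * α.θ g y‖ < δ) :
    ‖α.θ g (p * x) - q * α.θ g x‖ < 3 * δ := by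
  have hd := α.sub_mem _ hx hy
  have key : α.θ g (p * x) - q * α.θ g x =
      α.θ g (p * (x - y)) + (α.θ g (p * y) - q * α.θ g y) - q * α.θ g (x - y) := by
    rw [mul_sub, α.θ_sub g (α.mul_mem_left _ _ _ hx) (α.mul_mem_left _ _ _ hy),
      α.θ_sub g hx hy, mul_sub]
    abel
  have h₁ : ‖α.θ g (p * (x - y))‖ ≤ ‖x - y‖ :=
    (α.norm_θ_le g (α.mul_mem_left _ _ _ hd)).trans <|
      (norm_mul_le _ _).trans (mul_le_of_le_one_left (norm_nonneg _) hp)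
  have h₂ : ‖q * α.θ g (x - y)‖ ≤ ‖x - y‖ :=
    (norm_mul_le _ _).trans <| (mul_le_of_le_one_left (norm_nonneg _) hq).trans
      (α.norm_θ_le g hd)
  rw [key]
  linarith [norm_sub_le (α.θ g (p * (x - y)) + (α.θ g (p * y) - q * α.θ g y))
    (q * α.θ g (x - y)), norm_add_le (α.θ g (p * (x - y))) (α.θ g (p * y) - q * α.θ g y)]

end CStarPartialAction

/-- The commutator of a contraction `p` with `x` is controlled by the one with a nearby point
`y`. -/
lemma norm_mul_sub_mul_lt_of_norm_sub_lt {L : Type*} [NormedRing L] {p x y : L} {δ : ℝ}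
    (hp : ‖p‖ ≤ 1) (hxy : ‖x - y‖ < δ) (h : ‖p * y - y * p‖ < δ) :
    ‖p * x - x * p‖ < 3 * δ := by
  have key : p * x - x * p = p * (x - y) + (p * y - y * p) - (x - y) * p := by noncomm_ring
  have h₁ : ‖p * (x - y)‖ ≤ ‖x - y‖ :=
    (norm_mul_le _ _).trans (mul_le_of_le_one_left (norm_nonneg _) hp)
  have h₂ : ‖(x - y) * p‖ ≤ ‖x - y‖ :=
    (norm_mul_le _ _).trans (mul_le_of_le_one_right (norm_nonneg _) hp)
  rw [key]
  linarith [norm_sub_le (p * (x - y) + (p * y - y * p)) ((x - y) * p),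
    norm_add_le (p * (x - y)) (p * y - y * p)]

/-- Elements of the closed union of the images of the ideals `A⁽ⁱ⁾_g` are approximated from every
sufficiently late stage of the sequence. -/
lemma eventually_exists_norm_sub_lt {G : Type*} [Group G] {A : ℕ → Type*}
    [∀ i, CStarAlgebra (A i)] {L : Type*} [CStarAlgebra L]
    {pa : ∀ i, CStarPartialAction G (A i)} {φ : ∀ i, A i →⋆ₐ[ℂ] A (i + 1)}
    (hφ : ∀ i, IsEquivariantMap (pa i) (pa (i + 1)) (φ i)) {μ : ∀ i, A i →⋆ₐ[ℂ] L}
    (hμφ : ∀ i (a : A i), μ (i + 1) (φ i a) = μ i a) {g : G} {x : L}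
    (hx : x ∈ closure (⋃ i, μ i '' (pa i).I g)) {δ : ℝ} (hδ : 0 < δ) :
    ∀ᶠ i in Filter.atTop, ∃ y ∈ (pa i).I g, ‖x - μ i y‖ < δ := by
  obtain ⟨_, hb, hxb⟩ := Metric.mem_closure_iff.1 hx δ hδ
  obtain ⟨n, a, ha, rfl⟩ := Set.mem_iUnion.1 hb
  filter_upwards [Filter.eventually_ge_atTop n] with i hi
  induction i, hi using Nat.le_induction with
  | base => exact ⟨a, ha, by rwa [← dist_eq_norm]⟩
  | succ i _ ih =>
    obtain ⟨y, hy, hxy⟩ := ih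
    exact ⟨φ i y, (hφ i).1 g ⟨y, hy, rfl⟩, by rwa [hμφ]⟩

variable
    {G : Type*} [Group G] [Fintype G]
    {A : ℕ → Type*} [∀ i, CStarAlgebra (A i)]
    [∀ i, PartialOrder (A i)] [∀ i, StarOrderedRing (A i)]
    {L : Type*} [CStarAlgebra L] [PartialOrder L] [StarOrderedRing L]

/-- If `(L, μ)` is a concrete inductive limit of an inductive sequence of
partial dynamical systems on unital C*-algebras with unital connecting maps, `α` is the
inductive limit partial action, and infinitely many of the `α⁽ⁱ⁾` have Rokhlin dimension
with commuting towers at most `k`, then `α` has Rokhlin dimension with commuting towers at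
most `k` (hence `dim^c_Rok α ≤ liminf dim^c_Rok α⁽ⁱ⁾`). -/
theorem rokhlinDimWithCommutingTowers_inductive_limit_partial_action
    (pa : ∀ i, CStarPartialAction G (A i))
    (φ : ∀ i, A i →⋆ₐ[ℂ] A (i + 1))
    (hφ : ∀ i, IsEquivariantMap (pa i) (pa (i + 1)) (φ i))
    (μ : ∀ i, A i →⋆ₐ[ℂ] L)
    (hμφ : ∀ i (a : A i), μ (i + 1) (φ i a) = μ i a)
    (hdense : closure (⋃ i, Set.range (μ i)) = Set.univ)
    (hnorm : ∀ i (a : A i),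
      Filter.Tendsto (fun j => ‖iterMap (fun i => ⇑(φ i)) i j a‖) Filter.atTop
        (nhds ‖μ i a‖))
    (α : CStarPartialAction G L)
    (hαI : ∀ g, α.I g = closure (⋃ i, μ i '' (pa i).I g))
    (hαθ : ∀ (g : G) (i : ℕ), ∀ a ∈ (pa i).I g⁻¹, α.θ g (μ i a) = μ i ((pa i).θ g a))
    (k : ℕ) (hk : ∀ N : ℕ, ∃ i, N ≤ i ∧ HasRokhlinDimWithCommutingTowersLE (pa i) k) :
    HasRokhlinDimWithCommutingTowersLE α k := by
  classical
  intro ε hε F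
  have hδ : 0 < ε / 3 := by positivity
  have happ : ∀ᶠ i in Filter.atTop, ∀ x ∈ F, ∀ g : G, x ∈ α.I g →
      ∃ y ∈ (pa i).I g, ‖x - μ i y‖ < ε / 3 := by
    refine (Filter.eventually_all_finset F).2 fun x _ => Filter.eventually_all.2 fun g => ?_
    by_cases hx : x ∈ α.I g
    · filter_upwards [eventually_exists_norm_sub_lt hφ hμφ (hαI g ▸ hx) hδ] with i hi _ using hi
    · exact Filter.Eventually.of_forall fun _ h => absurd h hx
  obtain ⟨N, hN⟩ := Filter.eventually_atTop.1 happ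
  obtain ⟨i, hi, hR⟩ := hk N
  have hy : ∀ (x : L) (g : G), ∃ y : A i, x ∈ F → x ∈ α.I g →
      y ∈ (pa i).I g ∧ ‖x - μ i y‖ < ε / 3 := fun x g => by
    by_cases h : x ∈ F ∧ x ∈ α.I g
    · obtain ⟨y, hy⟩ := hN i hi x h.1 g h.2
      exact ⟨y, fun _ _ => hy⟩
    · exact ⟨0, fun h₁ h₂ => absurd ⟨h₁, h₂⟩ h⟩
  choose y hy using hy
  have hyF : ∀ x ∈ F, ∀ g, y x g ∈ (F ×ˢ Finset.univ).image fun p : L × G => y p.1 p.2 :=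
    fun x hx g => Finset.mem_image.2 ⟨(x, g), by simp [hx], rfl⟩
  obtain ⟨f, hf, hθ, horth, hsum, hcomm, htow⟩ :=
    hR (ε / 3) hδ ((F ×ˢ Finset.univ).image fun p => y p.1 p.2)
  have hμI : ∀ g, ∀ a ∈ (pa i).I g, μ i a ∈ α.I g := fun g a ha =>
    hαI g ▸ subset_closure (Set.mem_iUnion.2 ⟨i, a, ha, rfl⟩)
  have hμle : ∀ a, ‖μ i a‖ ≤ ‖a‖ := NonUnitalStarAlgHom.norm_apply_le (μ i)
  have hμf : ∀ j g, ‖μ i (f j g)‖ ≤ 1 := fun j g => (hμle _).trans (hf j g).2.2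
  have hlt : ε / 3 < ε := by linarith
  have h3 : 3 * (ε / 3) = ε := by ring
  refine ⟨fun j g => μ i (f j g),
    fun j g => ⟨hμI g _ (hf j g).1, map_nonneg (μ i) (hf j g).2.1, hμf j g⟩, ?_, ?_, ?_, ?_, ?_⟩
  · intro g h j x hx hxI
    obtain ⟨hyI, hxy⟩ := hy x g⁻¹ hx hxI
    refine h3 ▸ α.norm_θ_mul_sub_lt g (hμf _ _) (hμf _ _) hxI (hμI _ _ hyI) hxy ?_
    rw [← map_mul, hαθ g i _ hyI, hαθ g i _ ((pa i).mul_mem_left _ _ _ hyI), ← map_mul, ← map_sub]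
    exact (hμle _).trans_lt (hθ g h j _ (hyF x hx _) hyI)
  · intro j g h hgh
    rw [← map_mul]
    exact ((hμle _).trans_lt (horth j g h hgh)).trans hlt
  · simp_rw [← map_sum]
    rw [← map_one (μ i), ← map_sub]
    exact ((hμle _).trans_lt hsum).trans hlt
  · intro j g x hx
    obtain ⟨-, hxy⟩ := hy x 1 hx (α.I_one ▸ Set.mem_univ x)
    refine h3 ▸ norm_mul_sub_mul_lt_of_norm_sub_lt (hμf _ _) hxy ?_
    rw [← map_mul, ← map_mul, ← map_sub]
    exact (hμle _).trans_lt (hcomm j g _ (hyF x hx 1))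
  · intro j l g h
    rw [← map_mul, ← map_mul, ← map_sub]
    exact ((hμle _).trans_lt (htow j l g h)).trans hlt
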